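/- arXiv:2312.03010 — 2 statements merged into one kernel-verified Lean document; each statement's English description precedes it below -/
import Mathlib

section
/- Let p be a prime with p ≥ 5. Then there exists a nondegenerate simplicial map from X(F_2^4) to X(F_p^4): there is a function f : (Fin 4 → ZMod 2) → (Fin 4 → ZMod p) such that for every finset s of vectors in (Fin 4 → ZMod 2) that is linearly independent over ZMod 2, the family (f v) for v ∈ s is linearly independent over ZMod p. (Indeed the map sending each 0/1 vector over ZMod 2 to the vector with the same 0/1 coordinates over ZMod p works, since the absolute determinant of a 4×4 matrix with 0/1 entries is at most 3 < p. Consequently s_p(X(F_2^4)) = 15 − 4 = 11 for every prime p ≥ 5.) -/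
/-- The signed maximal minors of a `3 × 4` matrix with entries in `{0, 1}` have both their positive
parts and their negative parts summing to at most `3`. -/
theorem sum_minors_zero_one_le_three :
    ∀ a ∈ ({0, 1} : Finset ℤ), ∀ b ∈ ({0, 1} : Finset ℤ), ∀ c ∈ ({0, 1} : Finset ℤ),
    ∀ d ∈ ({0, 1} : Finset ℤ), ∀ e ∈ ({0, 1} : Finset ℤ), ∀ f ∈ ({0, 1} : Finset ℤ),
    ∀ g ∈ ({0, 1} : Finset ℤ), ∀ h ∈ ({0, 1} : Finset ℤ), ∀ i ∈ ({0, 1} : Finset ℤ),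
    ∀ j ∈ ({0, 1} : Finset ℤ), ∀ k ∈ ({0, 1} : Finset ℤ), ∀ l ∈ ({0, 1} : Finset ℤ),
      max (b * (g * l - h * k) - c * (f * l - h * j) + d * (f * k - g * j)) 0 +
        max (-(a * (g * l - h * k) - c * (e * l - h * i) + d * (e * k - g * i))) 0 +
        max (a * (f * l - h * j) - b * (e * l - h * i) + d * (e * j - f * i)) 0 +
        max (-(a * (f * k - g * j) - b * (e * k - g * i) + c * (e * j - f * i))) 0 ≤ 3 ∧
      max (-(b * (g * l - h * k) - c * (f * l - h * j) + d * (f * k - g * j))) 0 +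
        max (a * (g * l - h * k) - c * (e * l - h * i) + d * (e * k - g * i)) 0 +
        max (-(a * (f * l - h * j) - b * (e * l - h * i) + d * (e * j - f * i))) 0 +
        max (a * (f * k - g * j) - b * (e * k - g * i) + c * (e * j - f * i)) 0 ≤ 3 := by
  decide +kernel

theorem mul_le_max_zero_of_mem_zero_one {x : ℤ} (hx : x ∈ ({0, 1} : Finset ℤ)) (c : ℤ) :
    -max (-c) 0 ≤ x * c ∧ x * c ≤ max c 0 := by
  simp only [Finset.mem_insert, Finset.mem_singleton] at hx
  rcases hx with rfl | rfl <;> constructor <;> omega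

theorem abs_det_zero_one_le_three (N : Matrix (Fin 4) (Fin 4) ℤ)
    (hN : ∀ i j, N i j ∈ ({0, 1} : Finset ℤ)) : |N.det| ≤ 3 := by
  obtain ⟨hpos, hneg⟩ := sum_minors_zero_one_le_three
    _ (hN 1 0) _ (hN 1 1) _ (hN 1 2) _ (hN 1 3) _ (hN 2 0) _ (hN 2 1) _ (hN 2 2) _ (hN 2 3)
    _ (hN 3 0) _ (hN 3 1) _ (hN 3 2) _ (hN 3 3)
  set m₀ := N 1 1 * (N 2 2 * N 3 3 - N 2 3 * N 3 2) - N 1 2 * (N 2 1 * N 3 3 - N 2 3 * N 3 1) +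
    N 1 3 * (N 2 1 * N 3 2 - N 2 2 * N 3 1) with hm₀
  set m₁ := N 1 0 * (N 2 2 * N 3 3 - N 2 3 * N 3 2) - N 1 2 * (N 2 0 * N 3 3 - N 2 3 * N 3 0) +
    N 1 3 * (N 2 0 * N 3 2 - N 2 2 * N 3 0) with hm₁
  set m₂ := N 1 0 * (N 2 1 * N 3 3 - N 2 3 * N 3 1) - N 1 1 * (N 2 0 * N 3 3 - N 2 3 * N 3 0) +
    N 1 3 * (N 2 0 * N 3 1 - N 2 1 * N 3 0) with hm₂
  set m₃ := N 1 0 * (N 2 1 * N 3 2 - N 2 2 * N 3 1) - N 1 1 * (N 2 0 * N 3 2 - N 2 2 * N 3 0) +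
    N 1 2 * (N 2 0 * N 3 1 - N 2 1 * N 3 0) with hm₃
  have hdet : N.det = N 0 0 * m₀ + N 0 1 * -m₁ + N 0 2 * m₂ + N 0 3 * -m₃ := by
    rw [hm₀, hm₁, hm₂, hm₃, Matrix.det_succ_row_zero]
    simp [Fin.sum_univ_succ, Matrix.det_fin_three, Fin.succAbove]
    ring
  have h₀ := mul_le_max_zero_of_mem_zero_one (hN 0 0) m₀
  have h₁ := mul_le_max_zero_of_mem_zero_one (hN 0 1) (-m₁)
  have h₂ := mul_le_max_zero_of_mem_zero_one (hN 0 2) m₂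
  have h₃ := mul_le_max_zero_of_mem_zero_one (hN 0 3) (-m₃)
  simp only [neg_neg] at h₁ h₃
  rw [hdet, abs_le]
  constructor <;> linarith

/-- For `p ≥ 5`, reading the entries of an invertible `4 × 4` matrix over `ZMod 2` as `0` and `1`
in `ZMod p` gives a matrix with nonzero determinant. -/
theorem det_zmod_two_lift_ne_zero {p : ℕ} (hp5 : 5 ≤ p) {M : Matrix (Fin 4) (Fin 4) (ZMod 2)}
    (hM : M.det ≠ 0) : (M.map fun x => (x.val : ZMod p)).det ≠ 0 := by
  set N : Matrix (Fin 4) (Fin 4) ℤ := M.map fun x => (x.val : ℤ)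
  have hle : |N.det| ≤ 3 := by
    refine abs_det_zero_one_le_three N fun i j => ?_
    have key : ∀ x : ZMod 2, (x.val : ℤ) ∈ ({0, 1} : Finset ℤ) := by decide
    exact key (M i j)
  have hM' : M.det = (N.det : ZMod 2) := by
    rw [Int.cast_det]
    congr 1
    ext i j
    simp [N]
  have hp' : (M.map fun x => (x.val : ZMod p)).det = (N.det : ZMod p) := by
    rw [Int.cast_det]
    congr 1
    ext i j
    simp [N]
  have hN : N.det ≠ 0 := by
    rintro h
    exact hM (by rw [hM', h, Int.cast_zero])
  rw [hp', Ne, ZMod.intCast_zmod_eq_zero_iff_dvd]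
  intro hdvd
  have := Int.le_of_dvd (abs_pos.mpr hN) ((dvd_abs _ _).mpr hdvd)
  omega

/-- For every prime `p ≥ 5` there is a nondegenerate simplicial map from
`X(F_2^4)` to `X(F_p^4)`.  (Consequently `s_p(X(F_2^4)) = 15 − 4 = 11`.) -/
theorem stmt15 (p : ℕ) (hp : p.Prime) (hp5 : 5 ≤ p) :
    ∃ f : (Fin 4 → ZMod 2) → (Fin 4 → ZMod p),
      ∀ s : Finset (Fin 4 → ZMod 2),
        LinearIndependent (ZMod 2) (fun v : s => (v.1 : Fin 4 → ZMod 2)) →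
        LinearIndependent (ZMod p) (fun v : s => f v.1) := by
  have : Fact p.Prime := ⟨hp⟩
  refine ⟨fun v i => ((v i).val : ZMod p), fun s hs => ?_⟩
  have hs' : LinearIndepOn (ZMod 2) id (s : Set (Fin 4 → ZMod 2)) := hs
  let b := Module.Basis.extend hs'
  let e := b.indexEquiv (Pi.basisFun (ZMod 2) (Fin 4))
  let M : Matrix (Fin 4) (Fin 4) (ZMod 2) := Matrix.of fun i => (e.symm i).1
  have hrows : LinearIndependent (ZMod 2) M.row := by
    have h := b.linearIndependent.comp e.symm e.symm.injective
    rwa [Module.Basis.coe_extend] at h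
  have hM : M.det ≠ 0 :=
    ((Matrix.isUnit_iff_isUnit_det M).mp
      (Matrix.linearIndependent_rows_iff_isUnit.mp hrows)).ne_zero
  have hlift := Matrix.linearIndependent_rows_of_det_ne_zero (det_zmod_two_lift_ne_zero hp5 hM)
  let ι : s → Fin 4 := fun v => e ⟨v.1, hs'.subset_extend (Set.subset_univ _) v.2⟩
  have hι : Function.Injective ι := fun v w h =>
    Subtype.ext (Subtype.mk.inj (e.injective h))
  convert hlift.comp ι hι using 1
  ext v i
  simp [M, ι]
end

section
/- There exists a nondegenerate simplicial map from X(F_3^3) to X(F_2^5) (a function f : (Fin 3 → ZMod 3) → (Fin 5 → ZMod 2) such that for every finset s of vectors in (Fin 3 → ZMod 3) linearly independent over ZMod 3, the family (f v), v ∈ s, is linearly independent over ZMod 2), and there is no nondegenerate simplicial map from X(F_3^3) to X(F_2^4). (Consequently s_2(X(F_3^3)) = 26 − 5 = 21.) -/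
/-- At most three distinct binary vectors, all with first coordinate `1`, are linearly independent:
the complement of a hyperplane is a cap. -/
lemma linearIndependent_of_apply_zero_eq_one {ι : Type*} [Fintype ι] {n : ℕ}
    (hι : Fintype.card ι ≤ 3) (w : ι → Fin (n + 1) → ZMod 2) (hw : Function.Injective w)
    (h0 : ∀ i, w i 0 = 1) : LinearIndependent (ZMod 2) w := by
  classical
  rw [Fintype.linearIndependent_iff]
  intro c hc
  set T := Finset.univ.filter fun i => c i ≠ 0 with hT
  have hsum : ∑ i ∈ T, w i = 0 := by
    rw [← hc, hT, Finset.sum_filter]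
    refine Finset.sum_congr rfl fun i _ => ?_
    rcases (by decide : ∀ a : ZMod 2, a = 0 ∨ a = 1) (c i) with h | h <;> simp [h]
  have heven : Even T.card := by
    rw [← ZMod.natCast_eq_zero_iff_even]
    simpa [Finset.sum_apply, h0] using congrFun hsum 0
  have hle : T.card ≤ 3 := (Finset.card_le_univ T).trans hι
  have hcard : T.card = 0 ∨ T.card = 2 := by
    obtain ⟨k, hk⟩ := heven
    omega
  rcases hcard with h | h
  · intro i
    by_contra hi
    have : i ∈ T := by simp [hT, hi]
    simp [Finset.card_eq_zero.mp h] at this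
  · obtain ⟨i, j, hij, hTij⟩ := Finset.card_eq_two.mp h
    rw [hTij, Finset.sum_pair hij, CharTwo.add_eq_zero] at hsum
    exact absurd (hw hsum) hij

open scoped LinearAlgebra.Projectivization in
/-- The thirteen points of the projective plane over `F_3` embed into `F_2^4`. -/
lemma exists_embedding_projectivization :
    Nonempty (ℙ (ZMod 3) (Fin 3 → ZMod 3) ↪ (Fin 4 → ZMod 2)) := by
  classical
  have := Fintype.ofFinite (ℙ (ZMod 3) (Fin 3 → ZMod 3))
  refine Function.Embedding.nonempty_of_card_le ?_
  have h := Projectivization.card_of_finrank (ZMod 3) (Fin 3 → ZMod 3) (n := 3) (by simp)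
  rw [Nat.card_eq_fintype_card] at h
  rw [h]
  simp [Finset.sum_range_succ]

lemma exists_nondegenerate_map_five :
    ∃ f : (Fin 3 → ZMod 3) → (Fin 5 → ZMod 2),
      ∀ s : Finset (Fin 3 → ZMod 3),
        LinearIndependent (ZMod 3) (fun v : s => (v.1 : Fin 3 → ZMod 3)) →
        LinearIndependent (ZMod 2) (fun v : s => f v.1) := by
  classical
  obtain ⟨e⟩ := exists_embedding_projectivization
  refine ⟨fun v => if h : v ≠ 0 then Fin.cons 1 (e (.mk _ v h)) else 0, fun s hs => ?_⟩
  have hne (v : s) : v.1 ≠ 0 := hs.ne_zero v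
  refine linearIndependent_of_apply_zero_eq_one ?_ _ ?_ ?_
  · simpa using hs.fintype_card_le_finrank
  · intro u v huv
    simp only [dif_pos (hne u), dif_pos (hne v)] at huv
    obtain ⟨a, ha⟩ := (Projectivization.mk_eq_mk_iff' _ _ _ _ _).mp
      (e.injective (Fin.cons_right_injective _ huv))
    by_contra huv'
    have hpair := hs.comp ![u, v]
      (by simpa [Function.Injective, Fin.forall_fin_two, eq_comm] using huv')
    simpa using Fintype.linearIndependent_iff.mp hpair ![1, -a] (by simp [ha]) 0
  · intro v
    simp [dif_pos (hne v)]

/-- Nondegenerate maps preserve the independence of families, not only of finsets. -/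
lemma LinearIndependent.comp_of_forall_finset {K L V W ι : Type*} [Field K] [Field L]
    [AddCommGroup V] [Module K V] [AddCommGroup W] [Module L W] [Fintype ι] {g : V → W}
    (hg : ∀ s : Finset V, LinearIndependent K (fun v : s => v.1) →
      LinearIndependent L (fun v : s => g v.1))
    {v : ι → V} (hv : LinearIndependent K v) : LinearIndependent L (g ∘ v) := by
  classical
  have h := hg (Finset.univ.image v) (by
    have := hv.linearIndepOn_id
    rw [← Set.image_univ, ← Finset.coe_univ, ← Finset.coe_image] at this
    exact this)
  exact h.comp (fun i => ⟨v i, Finset.mem_image_of_mem _ (Finset.mem_univ i)⟩)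
    fun i j hij => hv.injective (congrArg Subtype.val hij)

/-- The affine points of the four lines through `(1, 0, 0)` in the projective plane over `F_3`. -/
def pencilPoint (i : Fin 4) (j : ZMod 3) : Fin 3 → ZMod 3 :=
  ![j, ![0, 1, 1, 1] i, ![1, 0, 1, 2] i]

lemma linearIndependent_of_det_fin_three_ne_zero {K : Type*} [Field K] (v : Fin 3 → Fin 3 → K)
    (h : v 0 0 * v 1 1 * v 2 2 - v 0 0 * v 1 2 * v 2 1 - v 0 1 * v 1 0 * v 2 2
      + v 0 1 * v 1 2 * v 2 0 + v 0 2 * v 1 0 * v 2 1 - v 0 2 * v 1 1 * v 2 0 ≠ 0) :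
    LinearIndependent K v := by
  have := Matrix.linearIndependent_rows_iff_isUnit (A := Matrix.of v)
  refine this.mpr ((Matrix.isUnit_iff_isUnit_det _).mpr (isUnit_iff_ne_zero.mpr ?_))
  rw [Matrix.det_fin_three]
  exact h

lemma linearIndependent_pencilPoint_of_ne {i i' : Fin 4} (hi : i ≠ i') (j j' : ZMod 3) :
    LinearIndependent (ZMod 3) ![![1, 0, 0], pencilPoint i j, pencilPoint i' j'] := by
  apply linearIndependent_of_det_fin_three_ne_zero
  revert i i' j j'
  decide

lemma linearIndependent_pencilPoint_pair {j j' : ZMod 3} (hj : j ≠ j') (i : Fin 4) :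
    LinearIndependent (ZMod 3) ![pencilPoint i j, pencilPoint i j', pencilPoint (i + 1) 0] := by
  apply linearIndependent_of_det_fin_three_ne_zero
  revert i j j'
  decide

/-- Modulo the image of `(1, 0, 0)`, each of the four lines through that point would contribute two
nonzero vectors of `F_2^3`, and different lines different vectors: more than there are. -/
lemma not_exists_nondegenerate_map_four :
    ¬ ∃ g : (Fin 3 → ZMod 3) → (Fin 4 → ZMod 2),
      ∀ s : Finset (Fin 3 → ZMod 3),
        LinearIndependent (ZMod 3) (fun v : s => (v.1 : Fin 3 → ZMod 3)) →
        LinearIndependent (ZMod 2) (fun v : s => g v.1) := by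
  classical
  rintro ⟨g, hg⟩
  set x := g ![1, 0, 0]
  set N := Submodule.span (ZMod 2) {x} with hN
  have hmk {y z : Fin 4 → ZMod 2} (h : N.mkQ y = N.mkQ z) : y = z ∨ y = z + x := by
    obtain ⟨a, ha⟩ := Submodule.mem_span_singleton.mp ((Submodule.Quotient.eq N).mp h)
    rcases (by decide : ∀ a : ZMod 2, a = 0 ∨ a = 1) a with rfl | rfl
    · exact .inl (sub_eq_zero.mp (by simpa using ha.symm))
    · exact .inr (by rw [one_smul] at ha; rw [ha]; abel)
  have hli {i i' : Fin 4} (hi : i ≠ i') (j j' : ZMod 3) :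
      LinearIndependent (ZMod 2) ![x, g (pencilPoint i j), g (pencilPoint i' j')] := by
    have h := (linearIndependent_pencilPoint_of_ne hi j j').comp_of_forall_finset hg
    rwa [show g ∘ ![![1, 0, 0], pencilPoint i j, pencilPoint i' j'] =
      ![x, g (pencilPoint i j), g (pencilPoint i' j')] by ext k : 1; fin_cases k <;> rfl] at h
  have hne {i i' : Fin 4} (hi : i ≠ i') (j j' : ZMod 3) :
      N.mkQ (g (pencilPoint i j)) ≠ N.mkQ (g (pencilPoint i' j')) := by
    intro h
    have hl := Fintype.linearIndependent_iff.mp (hli hi j j')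
    rcases hmk h with h | h
    · simpa using hl ![0, 1, 1] (by simp [Fin.sum_univ_three, h, CharTwo.add_self_eq_zero]) 1
    · simpa using hl ![1, 1, 1] (by
        simp [Fin.sum_univ_three, h, add_left_comm x, CharTwo.add_self_eq_zero]) 1
  have hzero (i : Fin 4) (j : ZMod 3) : N.mkQ (g (pencilPoint i j)) ≠ 0 := by
    intro h
    have hl := Fintype.linearIndependent_iff.mp
      (hli (i := i) (i' := i + 1) (by simp) j 0)
    rw [← map_zero N.mkQ] at h
    rcases hmk h with h | h
    · simpa using hl ![0, 1, 0] (by simp [Fin.sum_univ_three, h]) 1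
    · simpa using hl ![1, 1, 0] (by simp [Fin.sum_univ_three, h, CharTwo.add_self_eq_zero]) 1
  have hinj {j j' : ZMod 3} (hj : j ≠ j') (i : Fin 4) :
      g (pencilPoint i j) ≠ g (pencilPoint i j') := fun h =>
    absurd (((linearIndependent_pencilPoint_pair hj i).comp_of_forall_finset hg).injective
      (a₁ := 0) (a₂ := 1) h) (by decide)
  have htwo (i : Fin 4) : ∃ j : ZMod 3,
      N.mkQ (g (pencilPoint i 0)) ≠ N.mkQ (g (pencilPoint i j)) := by
    by_contra! h
    have h1 := (hmk (h 1).symm).resolve_left (hinj (by decide) i)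
    have h2 := (hmk (h 2).symm).resolve_left (hinj (by decide) i)
    exact hinj (by decide : (1 : ZMod 3) ≠ 2) i (h1.trans h2.symm)
  choose j hj using htwo
  let F : Option (Fin 4 × Bool) → (Fin 4 → ZMod 2) ⧸ N := fun o =>
    o.elim 0 fun p => N.mkQ (g (pencilPoint p.1 (bif p.2 then j p.1 else 0)))
  have hF : Function.Injective F := by
    rintro (_ | ⟨i, b⟩) (_ | ⟨i', b'⟩) h
    · rfl
    · exact absurd h.symm (hzero _ _)
    · exact absurd h (hzero _ _)
    · obtain rfl : i = i' := by
        by_contra hi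
        exact hne hi _ _ h
      cases b <;> cases b'
      · rfl
      · exact absurd h (hj i)
      · exact absurd h.symm (hj i)
      · rfl
  have hx0 : x ≠ 0 := (hli (i := 0) (i' := 1) (by decide) 0 0).ne_zero 0
  have hrank : Module.finrank (ZMod 2) ((Fin 4 → ZMod 2) ⧸ N) = 3 := by
    have h := N.finrank_quotient_add_finrank
    rw [hN, finrank_span_singleton hx0, ← hN] at h
    simpa using h
  have hcard := Nat.card_le_card_of_injective F hF
  rw [Module.natCard_eq_pow_finrank (K := ZMod 2) (V := (Fin 4 → ZMod 2) ⧸ N), hrank] at hcard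
  simp at hcard

/-- There is a nondegenerate simplicial map from `X(F_3^3)` to `X(F_2^5)` but
none from `X(F_3^3)` to `X(F_2^4)`.  (Consequently `s_2(X(F_3^3)) = 26 − 5 = 21`.) -/
theorem stmt16 :
    (∃ f : (Fin 3 → ZMod 3) → (Fin 5 → ZMod 2),
      ∀ s : Finset (Fin 3 → ZMod 3),
        LinearIndependent (ZMod 3) (fun v : s => (v.1 : Fin 3 → ZMod 3)) →
        LinearIndependent (ZMod 2) (fun v : s => f v.1)) ∧
    ¬ (∃ g : (Fin 3 → ZMod 3) → (Fin 4 → ZMod 2),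
      ∀ s : Finset (Fin 3 → ZMod 3),
        LinearIndependent (ZMod 3) (fun v : s => (v.1 : Fin 3 → ZMod 3)) →
        LinearIndependent (ZMod 2) (fun v : s => g v.1)) :=
  ⟨exists_nondegenerate_map_five, not_exists_nondegenerate_map_four⟩
end
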